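/- arXiv:2106.02879 — 3 statements merged into one kernel-verified Lean document; each statement's English description precedes it below -/
import Mathlib

section
/- For all real numbers x and y, one has |x·log|x| − y·log|y|| ≤ |x−y|·log₊(1/|x−y|) + ( log₊(max(|x|,|y|)) + 1 + log 2 )·|x−y|. -/
open Real

/-- For `r ≥ 0`, `log₊ r := log (max r 1)`. -/
noncomputable def logPlus (r : ℝ) : ℝ := Real.log (max r 1)

theorem logPlus_nonneg (r : ℝ) : 0 ≤ logPlus r :=
  Real.log_nonneg (le_max_right r 1)

theorem log_le_logPlus {r : ℝ} (hr : 0 < r) : Real.log r ≤ logPlus r :=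
  Real.log_le_log hr (le_max_left r 1)

theorem mul_log_sub_mul_log_le {a b : ℝ} (ha : 0 ≤ a) (hb : 0 < b) :
    a * Real.log b - a * Real.log a ≤ b - a := by
  rcases ha.eq_or_lt with rfl | ha
  · simpa using hb.le
  · have h := mul_le_mul_of_nonneg_left (Real.log_le_sub_one_of_pos (div_pos hb ha)) ha.le
    rw [Real.log_div hb.ne' ha.ne', mul_sub, mul_sub, mul_div_cancel₀ _ ha.ne'] at h
    linarith

theorem mul_log_le_mul_log {a b : ℝ} (ha : 0 ≤ a) (hab : a ≤ b) :
    a * Real.log a ≤ a * Real.log b := by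
  rcases ha.eq_or_lt with rfl | ha
  · simp
  · exact mul_le_mul_of_nonneg_left (Real.log_le_log ha hab) ha.le

/-- The log-Lipschitz bound when the point of larger modulus is nonnegative. -/
theorem abs_mul_log_sub_le_of_abs_le {x y : ℝ} (h : |y| ≤ x) :
    |x * Real.log x - y * Real.log y| ≤
      (x - y) * logPlus (1 / (x - y)) + (logPlus x + 1 + Real.log 2) * (x - y) := by
  obtain ⟨hy₁, hy₂⟩ := abs_le.mp h
  rcases hy₂.eq_or_lt with rfl | hlt
  · simp
  have hx : 0 < x := by linarith
  have hd : 0 < x - y := by linarith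
  have hinv : (x - y) * -Real.log (x - y) ≤ (x - y) * logPlus (1 / (x - y)) := by
    refine mul_le_mul_of_nonneg_left ?_ hd.le
    simpa using log_le_logPlus (one_div_pos.mpr hd)
  have hinv₀ := mul_nonneg hd.le (logPlus_nonneg (1 / (x - y)))
  have hlog := mul_le_mul_of_nonneg_right (log_le_logPlus hx) hd.le
  have hlog₀ := mul_nonneg (logPlus_nonneg x) hd.le
  have htwo := mul_nonneg (Real.log_nonneg one_le_two) hd.le
  rcases le_total 0 y with hy | hy
  · have hupper := mul_log_sub_mul_log_le hy hx
    have hmono := mul_log_le_mul_log hy hlt.le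
    have hd_mono := mul_le_mul_of_nonneg_left
      (Real.log_le_log hd (by linarith : x - y ≤ x)) hd.le
    exact abs_le.mpr ⟨by linarith, by linarith⟩
  · have hmono := mul_log_le_mul_log (neg_nonneg.mpr hy) (by linarith : -y ≤ x)
    have hhalf : 0 < (x - y) / 2 := half_pos hd
    have hx_conv := mul_log_sub_mul_log_le hx.le hhalf
    have hy_conv := mul_log_sub_mul_log_le (neg_nonneg.mpr hy) hhalf
    rw [Real.log_div hd.ne' two_ne_zero] at hx_conv hy_conv
    rw [Real.log_neg_eq_log] at hmono hy_conv
    exact abs_le.mpr ⟨by linarith, by linarith⟩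

/-- The log-Lipschitz bound when the first point has the larger modulus. -/
theorem abs_mul_log_sub_le_of_abs_le_abs {x y : ℝ} (h : |y| ≤ |x|) :
    |x * Real.log x - y * Real.log y| ≤
      |x - y| * logPlus (1 / |x - y|) + (logPlus |x| + 1 + Real.log 2) * |x - y| := by
  rcases le_total 0 x with hx | hx
  · rw [abs_of_nonneg hx] at h ⊢
    rw [abs_of_nonneg (sub_nonneg.mpr (le_of_abs_le h))]
    exact abs_mul_log_sub_le_of_abs_le h
  · rw [abs_of_nonpos hx] at h ⊢
    rw [abs_of_nonpos (by linarith [neg_abs_le y] : x - y ≤ 0)]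
    have key := abs_mul_log_sub_le_of_abs_le (x := -x) (y := -y) (by rwa [abs_neg])
    rw [Real.log_neg_eq_log, Real.log_neg_eq_log] at key
    rw [← abs_neg]
    convert key using 2 <;> ring_nf

/-- The function `x ↦ x·log |x|` satisfies a local log-Lipschitz condition
(Example 2.3). -/
theorem xlogx_local_log_lipschitz (x y : ℝ) :
    abs (x * Real.log |x| - y * Real.log |y|) ≤
      |x - y| * logPlus (1 / |x - y|)
        + (logPlus (max |x| |y|) + 1 + Real.log 2) * |x - y| := by
  rw [Real.log_abs, Real.log_abs]
  rcases le_total |y| |x| with h | h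
  · rw [max_eq_left h]
    exact abs_mul_log_sub_le_of_abs_le_abs h
  · rw [max_eq_right h, abs_sub_comm (x * _), abs_sub_comm x]
    exact abs_mul_log_sub_le_of_abs_le_abs h
end

section
/- For all x, y ∈ ℝ, every θ ∈ [0,1], and all times 0 < s ≤ t, one has |p_t(x,y) − p_s(x,y)| ≤ ( (2√2)^θ · |t−s|^θ / s^θ ) · ( p_s(x,y) + p_t(x,y) + p_{2t}(x,y) ). -/
open MeasureTheory Real

/-- The one-dimensional heat kernel `p_t(x,y) = (2πt)^{-1/2} exp(-(x-y)²/(2t))`. -/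
noncomputable def heatKernel (t x y : ℝ) : ℝ :=
  (Real.sqrt (2 * Real.pi * t))⁻¹ * Real.exp (-(x - y) ^ 2 / (2 * t))

theorem heatKernel_nonneg (t x y : ℝ) : 0 ≤ heatKernel t x y := by
  unfold heatKernel
  positivity

/-- A quadratic weight is absorbed into the heat kernel at the doubled time. -/
theorem heatKernel_mul_sq_div_le {t : ℝ} (ht : 0 < t) (x y : ℝ) :
    heatKernel t x y * ((x - y) ^ 2 / (2 * t)) ≤ 2 * √2 * heatKernel (2 * t) x y := by
  unfold heatKernel
  set v := (x - y) ^ 2 / (2 * (2 * t)) with hv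
  have h₁ : (x - y) ^ 2 / (2 * t) = 2 * v := by rw [hv]; field_simp
  have h₂ : -(x - y) ^ 2 / (2 * t) = -v + -v := by rw [neg_div, h₁]; ring
  have h₃ : -(x - y) ^ 2 / (2 * (2 * t)) = -v := by rw [neg_div]
  have h₄ : √(2 * π * (2 * t)) = √2 * √(2 * π * t) := by
    rw [← Real.sqrt_mul (by norm_num)]
    ring_nf
  have h₅ : v * rexp (-v) ≤ 1 := by
    rw [Real.exp_neg, ← div_eq_mul_inv, div_le_one (Real.exp_pos v)]
    linarith [Real.add_one_le_exp v]
  rw [h₁, h₂, h₃, h₄, Real.exp_add]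
  have hpos : 0 < √(2 * π * t) := by positivity
  calc _ = 2 * ((√(2 * π * t))⁻¹ * rexp (-v)) * (v * rexp (-v)) := by ring
    _ ≤ 2 * ((√(2 * π * t))⁻¹ * rexp (-v)) * 1 := by gcongr
    _ = _ := by field_simp

/-- The decrease of the heat kernel between times `s ≤ t`. -/
theorem heatKernel_sub_le_of_le {s t : ℝ} (hs : 0 < s) (hst : s ≤ t) (x y : ℝ) :
    heatKernel s x y - heatKernel t x y ≤ (t - s) / s * heatKernel s x y := by
  have ht : 0 < t := hs.trans_le hst
  have hexp : rexp (-(x - y) ^ 2 / (2 * s)) ≤ rexp (-(x - y) ^ 2 / (2 * t)) := by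
    rw [neg_div, neg_div]
    gcongr
  have hsqrt : s / t * (√(2 * π * s))⁻¹ ≤ (√(2 * π * t))⁻¹ := by
    have hst' : √(2 * π * s) ≤ √(2 * π * t) := by gcongr
    have hs' : 0 < √(2 * π * s) := by positivity
    have hdiv : s / t = √(2 * π * s) ^ 2 / √(2 * π * t) ^ 2 := by
      rw [Real.sq_sqrt (by positivity), Real.sq_sqrt (by positivity)]
      field_simp
    have ht' : 0 < √(2 * π * t) := by positivity
    rw [hdiv]
    calc _ = √(2 * π * s) / √(2 * π * t) * (√(2 * π * t))⁻¹ := by field_simp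
      _ ≤ 1 * (√(2 * π * t))⁻¹ := by
        gcongr
        exact (div_le_one ht').2 hst'
      _ = _ := one_mul _
  have hlow : s / t * heatKernel s x y ≤ heatKernel t x y := by
    unfold heatKernel
    rw [← mul_assoc]
    gcongr
  have hratio : 1 - s / t ≤ (t - s) / s := by
    rw [one_sub_div ht.ne']
    exact div_le_div_of_nonneg_left (by linarith) hs hst
  nlinarith [mul_le_mul_of_nonneg_right hratio (heatKernel_nonneg s x y)]

/-- The increase of the heat kernel between times `s ≤ t`. -/
theorem heatKernel_sub_le_of_ge {s t : ℝ} (hs : 0 < s) (hst : s ≤ t) (x y : ℝ) :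
    heatKernel t x y - heatKernel s x y ≤
      2 * √2 * (t - s) / s * heatKernel (2 * t) x y := by
  have ht : 0 < t := hs.trans_le hst
  have hfactor : heatKernel t x y * (1 - (t - s) / s * ((x - y) ^ 2 / (2 * t))) ≤
      heatKernel s x y := by
    have hexp : rexp (-(x - y) ^ 2 / (2 * s)) =
        rexp (-(x - y) ^ 2 / (2 * t)) * rexp (-((t - s) / s * ((x - y) ^ 2 / (2 * t)))) := by
      rw [← Real.exp_add]
      congr 1
      field_simp
      ring
    have hbound := Real.one_sub_le_exp_neg ((t - s) / s * ((x - y) ^ 2 / (2 * t)))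
    calc _ ≤ heatKernel t x y * rexp (-((t - s) / s * ((x - y) ^ 2 / (2 * t)))) :=
        mul_le_mul_of_nonneg_left hbound (heatKernel_nonneg t x y)
      _ = (√(2 * π * t))⁻¹ * rexp (-(x - y) ^ 2 / (2 * s)) := by
        rw [hexp, heatKernel, mul_assoc]
      _ ≤ _ := by
        unfold heatKernel
        gcongr
  have hweight := mul_le_mul_of_nonneg_left (heatKernel_mul_sq_div_le ht x y)
    (div_nonneg (sub_nonneg.2 hst) hs.le)
  calc _ ≤ (t - s) / s * (heatKernel t x y * ((x - y) ^ 2 / (2 * t))) := by linarith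
    _ ≤ _ := hweight
    _ = _ := by ring

/-- Time-increment bound for the heat kernel (Lemma 3.4 (i)). -/
theorem heatKernel_time_increment (x y θ s t : ℝ)
    (hθ : θ ∈ Set.Icc (0:ℝ) 1) (hs : 0 < s) (hst : s ≤ t) :
    |heatKernel t x y - heatKernel s x y| ≤
      ((2 * Real.sqrt 2) ^ θ * |t - s| ^ θ / s ^ θ)
        * (heatKernel s x y + heatKernel t x y + heatKernel (2 * t) x y) := by
  have hr : 0 ≤ 2 * √2 * |t - s| / s := by positivity
  have hps := heatKernel_nonneg s x y
  have hpt := heatKernel_nonneg t x y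
  have hp2t := heatKernel_nonneg (2 * t) x y
  rw [← Real.mul_rpow (by positivity) (abs_nonneg _), ← Real.div_rpow (by positivity) hs.le]
  rcases le_total (2 * √2 * |t - s| / s) 1 with h | h
  · have hpow : 2 * √2 * |t - s| / s ≤ (2 * √2 * |t - s| / s) ^ θ := by
      simpa using Real.rpow_le_rpow_of_exponent_ge' hr h hθ.1 hθ.2
    refine le_trans ?_ (mul_le_mul_of_nonneg_right hpow (by positivity))
    rw [abs_of_nonneg (sub_nonneg.2 hst)] at hr ⊢
    have hratio : (t - s) / s ≤ 2 * √2 * (t - s) / s := by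
      have hone : 1 ≤ 2 * √2 := by linarith [Real.one_lt_sqrt_two]
      gcongr
      exact le_mul_of_one_le_left (sub_nonneg.2 hst) hone
    have hdec := (heatKernel_sub_le_of_le hs hst x y).trans
      (mul_le_mul_of_nonneg_right hratio hps)
    have hinc := heatKernel_sub_le_of_ge hs hst x y
    have hrs := mul_nonneg hr hps
    have hrt := mul_nonneg hr hpt
    have hr2t := mul_nonneg hr hp2t
    rw [mul_add, mul_add, abs_le]
    constructor <;> linarith
  · have hpow := Real.one_le_rpow h hθ.1
    refine le_trans ?_ (le_mul_of_one_le_left (by positivity) hpow)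
    rw [abs_le]
    constructor <;> linarith
end

section
/- For all x, y ∈ ℝ and every t > 0, one has ∫_ℝ |p_t(x,z) − p_t(y,z)| dz ≤ √(2/π) · |x−y| / √t. -/
open MeasureTheory Real

theorem heatKernel_eq_sub_zero (t x z : ℝ) : heatKernel t x z = heatKernel t (z - x) 0 := by
  unfold heatKernel
  congr 3
  ring

theorem heatKernel_le (t x y : ℝ) (ht : 0 < t) : heatKernel t x y ≤ (√(2 * π * t))⁻¹ := by
  unfold heatKernel
  refine mul_le_of_le_one_right (by positivity) (Real.exp_le_one_iff.2 ?_)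
  rw [neg_div]
  exact neg_nonpos.2 (by positivity)

theorem integrable_heatKernel_zero {t : ℝ} (ht : 0 < t) :
    Integrable (fun u : ℝ => heatKernel t u 0) := by
  have h := (integrable_exp_neg_mul_sq (b := (2 * t)⁻¹) (by positivity)).const_mul
    (√(2 * π * t))⁻¹
  refine h.congr (ae_of_all _ fun u => ?_)
  simp only [heatKernel]
  congr 2
  rw [sub_zero]
  field_simp

theorem integrable_heatKernel {t : ℝ} (ht : 0 < t) (x : ℝ) : Integrable (heatKernel t x) := by
  rw [funext (heatKernel_eq_sub_zero t x)]
  exact (integrable_heatKernel_zero ht).comp_sub_right x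

theorem setIntegral_Iic_comp_sub_right (g : ℝ → ℝ) (m x : ℝ) :
    ∫ z in Set.Iic m, g (z - x) = ∫ u in Set.Iic (m - x), g u := by
  have h := (measurePreserving_sub_right volume x).setIntegral_preimage_emb
    (measurableEmbedding_subRight x) g (Set.Iic (m - x))
  simpa using h

theorem heatKernel_le_heatKernel_of_le {t x y z : ℝ} (ht : 0 < t)
    (h : (x - z) ^ 2 ≤ (y - z) ^ 2) : heatKernel t y z ≤ heatKernel t x z := by
  unfold heatKernel
  gcongr

theorem setIntegral_Iic_heatKernel_sub_le {t x y : ℝ} (ht : 0 < t) (hxy : x ≤ y) (m : ℝ) :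
    ∫ z in Set.Iic m, (heatKernel t x z - heatKernel t y z) ≤ (√(2 * π * t))⁻¹ * (y - x) := by
  have hG := integrable_heatKernel_zero ht
  rw [integral_sub (integrable_heatKernel ht x).integrableOn
    (integrable_heatKernel ht y).integrableOn]
  simp only [heatKernel_eq_sub_zero t x, heatKernel_eq_sub_zero t y]
  rw [setIntegral_Iic_comp_sub_right (fun u => heatKernel t u 0),
    setIntegral_Iic_comp_sub_right (fun u => heatKernel t u 0),
    intervalIntegral.integral_Iic_sub_Iic hG.integrableOn hG.integrableOn]
  calc ∫ u in (m - y)..(m - x), heatKernel t u 0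
      ≤ ∫ _ in (m - y)..(m - x), (√(2 * π * t))⁻¹ :=
        intervalIntegral.integral_mono_on (by linarith) hG.intervalIntegrable (by simp)
          fun u _ => heatKernel_le t u 0 ht
    _ = (√(2 * π * t))⁻¹ * (y - x) := by
        rw [intervalIntegral.integral_const, smul_eq_mul]
        ring

theorem integral_heatKernel_sub {t : ℝ} (ht : 0 < t) (x y : ℝ) :
    ∫ z, (heatKernel t x z - heatKernel t y z) = 0 := by
  rw [integral_sub (integrable_heatKernel ht x) (integrable_heatKernel ht y)]
  simp only [heatKernel_eq_sub_zero t x, heatKernel_eq_sub_zero t y]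
  rw [integral_sub_right_eq_self (fun u => heatKernel t u 0),
    integral_sub_right_eq_self (fun u => heatKernel t u 0), sub_self]

theorem integral_abs_heatKernel_sub_le {t x y : ℝ} (ht : 0 < t) (hxy : x ≤ y) :
    ∫ z, |heatKernel t x z - heatKernel t y z| ≤ 2 * ((√(2 * π * t))⁻¹ * (y - x)) := by
  have hd : Integrable fun z => heatKernel t x z - heatKernel t y z :=
    (integrable_heatKernel ht x).sub (integrable_heatKernel ht y)
  have hle := setIntegral_Iic_heatKernel_sub_le ht hxy ((x + y) / 2)
  have hzero := integral_heatKernel_sub ht x y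
  rw [← integral_add_compl measurableSet_Iic hd (s := Set.Iic ((x + y) / 2))] at hzero
  rw [← integral_add_compl measurableSet_Iic hd.abs (s := Set.Iic ((x + y) / 2))]
  have h₁ : ∫ z in Set.Iic ((x + y) / 2), |heatKernel t x z - heatKernel t y z|
      = ∫ z in Set.Iic ((x + y) / 2), (heatKernel t x z - heatKernel t y z) := by
    refine setIntegral_congr_fun measurableSet_Iic fun z hz => ?_
    rw [Set.mem_Iic] at hz
    exact abs_of_nonneg (sub_nonneg.2 (heatKernel_le_heatKernel_of_le ht (by nlinarith)))
  have h₂ : ∫ z in (Set.Iic ((x + y) / 2))ᶜ, |heatKernel t x z - heatKernel t y z|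
      = -∫ z in (Set.Iic ((x + y) / 2))ᶜ, (heatKernel t x z - heatKernel t y z) := by
    rw [← integral_neg]
    refine setIntegral_congr_fun measurableSet_Iic.compl fun z hz => ?_
    rw [Set.mem_compl_iff, Set.mem_Iic, not_le] at hz
    exact abs_of_nonpos (sub_nonpos.2 (heatKernel_le_heatKernel_of_le ht (by nlinarith)))
  linarith

theorem two_mul_inv_sqrt_two_pi_mul (t : ℝ) : 2 * (√(2 * π * t))⁻¹ = √(2 / π) / √t := by
  have h : √2 * √2 = 2 := Real.mul_self_sqrt (by norm_num)
  rw [Real.sqrt_mul (by positivity), Real.sqrt_mul (by norm_num), Real.sqrt_div (by norm_num),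
    mul_inv, mul_inv, div_div, div_eq_mul_inv, mul_inv]
  nth_rewrite 1 [← h]
  field_simp

/-- L¹ spatial-increment bound for the heat kernel (Lemma 3.4 (ii)). -/
theorem heatKernel_space_increment_L1 (x y t : ℝ) (ht : 0 < t) :
    (∫ z : ℝ, |heatKernel t x z - heatKernel t y z|) ≤
      Real.sqrt (2 / Real.pi) * |x - y| / Real.sqrt t := by
  rw [mul_div_right_comm, ← two_mul_inv_sqrt_two_pi_mul, mul_assoc]
  rcases le_total x y with hxy | hxy
  · rw [abs_sub_comm x y, abs_of_nonneg (sub_nonneg.2 hxy)]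
    exact integral_abs_heatKernel_sub_le ht hxy
  · rw [abs_of_nonneg (sub_nonneg.2 hxy)]
    simp only [abs_sub_comm (heatKernel t x _)]
    exact integral_abs_heatKernel_sub_le ht hxy
end
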